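/- For the finite groups the analogous sphericity fails: there exist n ∈ ℕ and an irreducible finite-dimensional complex representation (V, ρ) of G_n = S_n × S_n × S_n such that the subspace {v ∈ V : ρ(h,h,h)v = v for all h ∈ S_n} of vectors fixed by the diagonal subgroup K_n has dimension at least 2. -/

import Mathlib

/-- A nonzero element of a semisimple ring acts nontrivially on some simple left ideal. -/
theorem IsSemisimpleRing.exists_isSimpleModule_mul_ne_zero {R : Type*} [Ring R]
    [IsSemisimpleRing R] {c : R} (hc : c ≠ 0) :
    ∃ S : Submodule R R, IsSimpleModule R S ∧ ∃ s ∈ S, c * s ≠ 0 := by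
  by_contra! h
  have hmem : c ∈ (⊤ : Submodule R R).annihilator := by
    rw [← IsSemisimpleModule.sSup_simples_eq_top R R, sSup_eq_iSup', Submodule.annihilator_iSup,
      Submodule.mem_iInf]
    exact fun S ↦ Submodule.mem_annihilator.2 (h S S.2)
  exact hc (by simpa using Submodule.mem_annihilator.1 hmem 1 trivial)

open MonoidAlgebra in
/-- A finite-dimensional simple module over a group algebra is an irreducible representation of the
group on a space of coordinate vectors. -/
theorem MonoidAlgebra.exists_coordinate_representation {k G V : Type*} [Field k] [Group G]
    [AddCommGroup V] [Module k V] [Module k[G] V] [IsScalarTower k k[G] V] [Module.Finite k V]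
    [IsSimpleModule k[G] V] :
    ∃ (d : ℕ) (ρ : G →* ((Fin d → k) ≃ₗ[k] (Fin d → k))) (e : V ≃ₗ[k] (Fin d → k)),
      (∀ g v, ρ g (e v) = e (single g (1 : k) • v)) ∧
      ∀ W : Submodule k (Fin d → k), (∀ g v, v ∈ W → ρ g v ∈ W) → W = ⊥ ∨ W = ⊤ := by
  let e : V ≃ₗ[k] (Fin (Module.finrank k V) → k) := (Module.finBasis k V).equivFun
  let σ : G →* Module.End k V :=
    ((Algebra.lsmul k k V : k[G] →ₐ[k] Module.End k V) : k[G] →* Module.End k V).comp (of k G)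
  let ρ : G →* ((Fin (Module.finrank k V) → k) ≃ₗ[k] (Fin (Module.finrank k V) → k)) :=
    (LinearMap.GeneralLinearGroup.generalLinearEquiv k _).toMonoidHom.comp
      (MonoidHom.toHomUnits ((e.conjRingEquiv : _ →* _).comp σ))
  have hρ (g : G) (v : V) : ρ g (e v) = e (single g (1 : k) • v) := by
    change e (single g (1 : k) • e.symm (e v)) = _
    rw [e.symm_apply_apply]
  refine ⟨_, ρ, e, hρ, fun W hW ↦ ?_⟩
  let U : Submodule k[G] V :=
    { toAddSubmonoid := (W.comap e.toLinearMap).toAddSubmonoid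
      smul_mem' := fun a v hv ↦ by
        change e v ∈ W at hv
        change e (a • v) ∈ W
        induction a using MonoidAlgebra.induction_linear with
        | zero => simp
        | add a b ha hb => rw [add_smul, map_add]; exact W.add_mem ha hb
        | single g r =>
          have : single g r = r • single g (1 : k) := by simp
          rw [this, smul_assoc, map_smul, ← hρ]
          exact W.smul_mem r (hW g _ hv) }
  have hU (v : V) : v ∈ U ↔ e v ∈ W := Iff.rfl
  refine (eq_bot_or_eq_top U).imp (fun h ↦ ?_) (fun h ↦ ?_)
  · refine (Submodule.eq_bot_iff W).2 fun x hx ↦ ?_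
    have : e.symm x ∈ U := (hU _).2 (by simpa using hx)
    simpa [h] using this
  · refine Submodule.eq_top_iff'.2 fun x ↦ ?_
    have : e.symm x ∈ U := h ▸ Submodule.mem_top
    simpa using (hU _).1 this

open MonoidAlgebra in
/-- If `g₁ g₂` lies outside the product `K g₂ K g₁ K`, then some irreducible representation of the
finite group `G` has at least two linearly independent `K`-fixed vectors. Here `K` is the image of
`φ`. -/
theorem exists_irreducible_two_fixed_vectors {k G H : Type*} [Field k] [CharZero k]
    [Group G] [Finite G] [Group H] [Finite H] (φ : H →* G) (g₁ g₂ : G)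
    (hg : ∀ a b c : H, φ a * g₂ * φ b * g₁ * φ c ≠ g₁ * g₂) :
    ∃ (d : ℕ) (ρ : G →* ((Fin d → k) ≃ₗ[k] (Fin d → k))),
      (∀ W : Submodule k (Fin d → k), (∀ g v, v ∈ W → ρ g v ∈ W) → W = ⊥ ∨ W = ⊤) ∧
      ∃ v w : Fin d → k, (∀ h, ρ (φ h) v = v) ∧ (∀ h, ρ (φ h) w = w) ∧
        LinearIndependent k ![v, w] := by
  classical
  have := Fintype.ofFinite H
  let E : k[G] := ∑ h : H, single (φ h) 1
  let x₁ : k[G] := single g₁ 1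
  let x₂ : k[G] := single g₂ 1
  have hE (h : H) : single (φ h) 1 * E = E := by
    simp only [E, Finset.mul_sum, single_mul_single, ← map_mul, mul_one]
    exact Fintype.sum_equiv (Equiv.mulLeft h) _ _ fun _ ↦ rfl
  have expand (u v : G) : E * single u 1 * E * single v 1 * E =
      ∑ p : H × H × H, single (φ p.2.2 * u * φ p.2.1 * v * φ p.1) (1 : k) := by
    simp only [E, Fintype.sum_prod_type, Finset.mul_sum, Finset.sum_mul, single_mul_single, mul_one]
  have hc : E * x₁ * E * x₂ * E - E * x₂ * E * x₁ * E ≠ 0 := by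
    intro h
    replace h := congrArg (fun y : k[G] ↦ y.coeff (g₁ * g₂)) (sub_eq_zero.1 h)
    simp only [x₁, x₂, expand, coeff_sum, Finsupp.finsetSum_apply, coeff_single,
      Finsupp.single_apply, hg, if_false, Finset.sum_const_zero, Finset.sum_boole,
      Nat.cast_eq_zero, Finset.card_eq_zero] at h
    simpa using Finset.filter_eq_empty_iff.1 h (Finset.mem_univ (1, 1, 1))
  obtain ⟨S, hS, s, hsS, hs⟩ := IsSemisimpleRing.exists_isSimpleModule_mul_ne_zero hc
  have : Module.Finite k S := Module.Finite.trans k[G] S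
  obtain ⟨d, ρ, e, hρ, hirr⟩ := exists_coordinate_representation (k := k) (G := G) (V := S)
  refine ⟨d, ρ, hirr, ?_⟩
  have hfix (v : S) (h : H) : ρ (φ h) (e (E • v)) = e (E • v) := by
    rw [hρ, ← mul_smul, hE]
  let s' : S := ⟨s, hsS⟩
  let t : S := E • s'
  have hne : E • x₁ • E • x₂ • t ≠ E • x₂ • E • x₁ • t := by
    intro h
    apply hs
    rw [sub_mul, sub_eq_zero]
    simpa [t, s', mul_assoc] using congrArg Subtype.val h
  have ht : t ≠ 0 := by
    intro h
    simp [h] at hne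
  have het : e t ≠ 0 := by simpa using ht
  by_contra! hno
  have key (x : k[G]) : ∃ r : k, E • x • t = r • t := by
    have := hno (e t) (e (E • x • t)) (hfix s') (hfix _)
    rw [LinearIndependent.pair_iff' het] at this
    push Not at this
    obtain ⟨r, hr⟩ := this
    exact ⟨r, e.injective (hr.symm.trans (e.map_smul r t).symm)⟩
  obtain ⟨r₁, h₁⟩ := key x₁
  obtain ⟨r₂, h₂⟩ := key x₂
  apply hne
  rw [h₁, h₂, smul_comm x₁ r₂, smul_comm x₂ r₁, smul_comm E r₂, smul_comm E r₁, h₁, h₂,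
    smul_comm]

set_option maxRecDepth 20000 in
open Equiv in
/-- No simultaneous conjugate of the pair `((0 1 4), (2 3))` times a simultaneous conjugate of
`((3 4), (0 1 2))` equals `((3 4)(0 1 4), (0 1 2)(2 3))`. -/
theorem perm_five_conj_mul_conj_ne (a h : Perm (Fin 5)) :
    (a * c[0, 1, 4] * a⁻¹ * (h * c[3, 4] * h⁻¹), a * c[2, 3] * a⁻¹ * (h * c[0, 1, 2] * h⁻¹)) ≠
      (c[3, 4] * c[0, 1, 4], c[0, 1, 2] * c[2, 3]) := by
  have key : ∀ h : Perm (Fin 5),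
      (c[3, 4] * c[0, 1, 4] * (h * c[3, 4] * h⁻¹)⁻¹) ^ 3 = 1 →
      ¬ (c[3, 4] * c[0, 1, 4] * (h * c[3, 4] * h⁻¹)⁻¹) *
        (c[0, 1, 2] * c[2, 3] * (h * c[0, 1, 2] * h⁻¹)⁻¹) =
        (c[0, 1, 2] * c[2, 3] * (h * c[0, 1, 2] * h⁻¹)⁻¹) *
        (c[3, 4] * c[0, 1, 4] * (h * c[3, 4] * h⁻¹)⁻¹) := by
    decide
  have hpow : (c[0, 1, 4] : Perm (Fin 5)) ^ 3 = 1 := by decide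
  have hcomm : (c[0, 1, 4] * c[2, 3] : Perm (Fin 5)) = c[2, 3] * c[0, 1, 4] := by decide
  intro heq
  obtain ⟨h₁, h₂⟩ := Prod.mk.inj heq
  apply key h
  · rw [← eq_mul_inv_iff_mul_eq.2 h₁, conj_pow, hpow, mul_one, mul_inv_cancel]
  · rw [← eq_mul_inv_iff_mul_eq.2 h₁, ← eq_mul_inv_iff_mul_eq.2 h₂, conj_mul, conj_mul, hcomm]

/-- For finite symmetric groups the analogue of sphericity fails:
there are `n` and an irreducible finite-dimensional complex representation of
`G_n = S_n × S_n × S_n` whose subspace of vectors fixed by the diagonal subgroup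
`K_n = {(h,h,h)}` has dimension at least `2` (it contains two linearly independent
fixed vectors). -/
theorem sphericity_fails_for_finite_symmetric_groups :
    ∃ (n d : ℕ)
      (ρ : (Equiv.Perm (Fin n) × Equiv.Perm (Fin n) × Equiv.Perm (Fin n)) →*
        ((Fin d → ℂ) ≃ₗ[ℂ] (Fin d → ℂ))),
      (∀ W : Submodule ℂ (Fin d → ℂ), (∀ (g) (v), v ∈ W → ρ g v ∈ W) → W = ⊥ ∨ W = ⊤) ∧
      ∃ v w : Fin d → ℂ,
        (∀ h : Equiv.Perm (Fin n), ρ (h, h, h) v = v) ∧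
        (∀ h : Equiv.Perm (Fin n), ρ (h, h, h) w = w) ∧
        LinearIndependent ℂ ![v, w] := by
  obtain ⟨d, ρ, hρ⟩ := exists_irreducible_two_fixed_vectors (k := ℂ)
    ((MonoidHom.id (Equiv.Perm (Fin 5))).prod ((MonoidHom.id _).prod (MonoidHom.id _)))
    (c[3, 4], c[0, 1, 2], 1) (c[0, 1, 4], c[2, 3], 1) fun a b c h ↦ by
      simp only [MonoidHom.prod_apply, MonoidHom.id_apply, Prod.mk_mul_mk, Prod.mk.injEq,
        mul_one] at h
      obtain ⟨h₁, h₂, h₃⟩ := h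
      obtain rfl : b = a⁻¹ * c⁻¹ :=
        eq_inv_mul_iff_mul_eq.2 (eq_inv_of_mul_eq_one_left h₃)
      refine perm_five_conj_mul_conj_ne a c⁻¹ (Prod.ext ?_ ?_)
      · simpa [mul_assoc] using h₁
      · simpa [mul_assoc] using h₂
  exact ⟨5, d, ρ, hρ⟩
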